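/- Let -D/2 ≤ x_I < x_F ≤ D/2. Suppose (r1I, r2I) ∈ C_f(x_I) and (r1F, r2F) ∈ C_f(x_F) with r1F < r1I, and suppose the line through these two points supports Conv( C_f(x_I) ∪ C_f(x_F) ) from above, i.e., every (s1, s2) ∈ C_f(x_I) ∪ C_f(x_F) satisfies s2 ≤ k·(s1 − r1I) + r2I, where k = (r2I − r2F)/(r1I − r1F). Define the triangle C_IF = { (s1, s2) : s1 ≥ 0, s2 ≥ 0, s2 ≤ k·(s1 − r1I) + r2I }. Then for every x ∈ [x_I, x_F]: C_f(x) ⊆ Conv( C_f(x_I) ∪ C_f(x_F) ) if and only if C_f(x) ⊆ C_IF, where Conv denotes the convex hull in ℝ². -/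

import Mathlib

/-- Channel power gain (normalized by noise) from the UAV at horizontal position `x`
to ground user 1 located at `-D/2`. -/
noncomputable def h1 (D H β0 x : ℝ) : ℝ := β0 / ((x + D / 2) ^ 2 + H ^ 2)

/-- Channel power gain from the UAV at horizontal position `x` to ground user 2
located at `D/2`. -/
noncomputable def h2 (D H β0 x : ℝ) : ℝ := β0 / ((x - D / 2) ^ 2 + H ^ 2)

/-- The fixed-location MAC-form region `C_MAC(x, p1, p2)`. -/
noncomputable def CMAC (D H β0 : ℝ) (x p1 p2 : ℝ) : Set (ℝ × ℝ) :=
  {r | 0 ≤ r.1 ∧ 0 ≤ r.2 ∧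
    r.1 ≤ Real.logb 2 (1 + p1 * h1 D H β0 x) ∧
    r.2 ≤ Real.logb 2 (1 + p2 * h2 D H β0 x) ∧
    r.1 + r.2 ≤ Real.logb 2 (1 + p1 * h1 D H β0 x + p2 * h2 D H β0 x)}

/-- The fixed-location capacity region `C_f(x)`: the union of `C_MAC(x, p1, p2)`
over all power splits `p1, p2 ≥ 0` with `p1 + p2 ≤ P`. -/
noncomputable def Cf (D H β0 P : ℝ) (x : ℝ) : Set (ℝ × ℝ) :=
  {r | ∃ p1 p2 : ℝ, 0 ≤ p1 ∧ 0 ≤ p2 ∧ p1 + p2 ≤ P ∧ r ∈ CMAC D H β0 x p1 p2}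

/-- The Pareto boundary function of `C_f(x)`: the largest `r2` such that
`(s, r2) ∈ C_f(x)`. -/
noncomputable def R2 (D H β0 P : ℝ) (x s : ℝ) : ℝ :=
  sSup {r2 : ℝ | (s, r2) ∈ Cf D H β0 P x}

/-- The least total power needed to reach the rate pair with `X = 2 ^ r₁ - 1`, `Y = 2 ^ r₂ - 1`
when the inverse channel gains are `A` and `B`. -/
noncomputable def powerCost (A B X Y : ℝ) : ℝ := A * X + B * Y + min A B * (X * Y)

/-- The rate pairs reachable with total power `P` and inverse channel gains `A` and `B`. -/
noncomputable def rateRegion (A B P : ℝ) : Set (ℝ × ℝ) :=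
  {r | 0 ≤ r.1 ∧ 0 ≤ r.2 ∧ powerCost A B (2 ^ r.1 - 1) (2 ^ r.2 - 1) ≤ P}

theorem powerCost_swap (A B X Y : ℝ) : powerCost A B X Y = powerCost B A Y X := by
  unfold powerCost
  rw [min_comm]
  ring

theorem mem_rateRegion_swap {A B P r₁ r₂ : ℝ} (h : (r₁, r₂) ∈ rateRegion A B P) :
    (r₂, r₁) ∈ rateRegion B A P :=
  ⟨h.2.1, h.1, by rw [powerCost_swap]; exact h.2.2⟩

theorem two_rpow_sub_one_nonneg {r : ℝ} (hr : 0 ≤ r) : 0 ≤ (2 : ℝ) ^ r - 1 :=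
  sub_nonneg.2 (Real.one_le_rpow (by norm_num) hr)

theorem two_rpow_sub_one_pos {r : ℝ} (hr : 0 < r) : 0 < (2 : ℝ) ^ r - 1 :=
  sub_pos.2 (Real.one_lt_rpow (by norm_num) hr)

theorem two_rpow_sub_one_le {r s : ℝ} (h : r ≤ s) : (2 : ℝ) ^ r - 1 ≤ (2 : ℝ) ^ s - 1 :=
  sub_le_sub_right (Real.rpow_le_rpow_of_exponent_le (by norm_num) h) 1

theorem mem_rateRegion_of_le {A B P r₁ r₂ s : ℝ} (hA : 0 < A) (hB : 0 < B)
    (h : (r₁, r₂) ∈ rateRegion A B P) (hs : 0 ≤ s) (hsr : s ≤ r₂) :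
    (r₁, s) ∈ rateRegion A B P := by
  obtain ⟨hr₁, hr₂, hc⟩ := h
  refine ⟨hr₁, hs, le_trans ?_ hc⟩
  have hX := two_rpow_sub_one_nonneg hr₁
  have hY := two_rpow_sub_one_le hsr
  have hm : 0 < min A B := lt_min hA hB
  dsimp only [powerCost] at hX ⊢
  have h1 := mul_le_mul_of_nonneg_left hY hB.le
  have h2 := mul_le_mul_of_nonneg_left (mul_le_mul_of_nonneg_left hY hX) hm.le
  linarith

/-- If the power cost at `(u, v)` is below the budget, then the second rate can be increased. -/
theorem exists_lt_mem_rateRegion {A B P u v : ℝ} (hA : 0 < A) (hB : 0 < B) (hu : 0 ≤ u)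
    (hv : 0 ≤ v) (hc : powerCost A B (2 ^ u - 1) (2 ^ v - 1) < P) :
    ∃ w, v < w ∧ (u, w) ∈ rateRegion A B P := by
  have hX := two_rpow_sub_one_nonneg hu
  have hY := two_rpow_sub_one_nonneg hv
  have hm : 0 < min A B := lt_min hA hB
  have hden : 0 < B + min A B * (2 ^ u - 1) := by positivity
  obtain ⟨Z, hZ⟩ : ∃ Z, (B + min A B * (2 ^ u - 1)) * Z = P - A * (2 ^ u - 1) :=
    ⟨_, mul_div_cancel₀ _ hden.ne'⟩
  have hYZ : (2 : ℝ) ^ v - 1 < Z := by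
    refine lt_of_mul_lt_mul_left ?_ hden.le
    unfold powerCost at hc
    linarith
  have hpow : (2 : ℝ) ^ Real.logb 2 (1 + Z) = 1 + Z :=
    Real.rpow_logb (by norm_num) (by norm_num) (by linarith)
  have hvw : v < Real.logb 2 (1 + Z) := by
    rw [Real.lt_logb_iff_rpow_lt (by norm_num) (by linarith)]
    linarith
  refine ⟨_, hvw, hu, hv.trans hvw.le, ?_⟩
  dsimp only
  rw [hpow]
  unfold powerCost
  linarith

theorem bilinear_neg_of_le {a b m X Y X' Y' : ℝ} (ha : 0 ≤ a) (hb : b ≤ 0) (hX' : 0 < X')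
    (hX : X' ≤ X) (hY : 0 ≤ Y) (hY' : Y ≤ Y') (h : a * X + b * Y + m * (X * Y) < 0) :
    a * X' + b * Y' + m * (X' * Y') < 0 := by
  have hX0 : 0 < X := hX'.trans_le hX
  have hY0 : 0 < Y := by
    rcases hY.lt_or_eq with h0 | h0
    · exact h0
    · rw [← h0] at h
      nlinarith
  have hY'0 : 0 < Y' := hY0.trans_le hY'
  have h1 : X' * Y' * (a * X + b * Y + m * (X * Y)) < 0 :=
    mul_neg_of_pos_of_neg (by positivity) h
  have h2 : a * X * X' * (Y - Y') ≤ 0 :=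
    mul_nonpos_of_nonneg_of_nonpos (by positivity) (by linarith)
  have h3 : b * (Y * Y' * (X - X')) ≤ 0 :=
    mul_nonpos_of_nonpos_of_nonneg hb (mul_nonneg (by positivity) (by linarith))
  by_contra! hcon
  have h4 : 0 ≤ X * Y * (a * X' + b * Y' + m * (X' * Y')) := by positivity
  linarith

/-- Single crossing of the boundaries of two rate regions: if the region with the larger first
gain dominates at first rate `u`, then it dominates at all larger first rates. -/
theorem mem_rateRegion_of_dominated {A B A₀ B₀ P u v s₁ s₂ : ℝ} (hA : 0 < A) (hB : 0 < B)
    (hAA : A₀ ≤ A) (hBB : B ≤ B₀) (hmem : (u, v) ∈ rateRegion A₀ B₀ P) (hu : 0 < u)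
    (hus : u ≤ s₁) (hsv : s₂ ≤ v) (hs : (s₁, s₂) ∈ rateRegion A B P)
    (hmax : ∀ w, (u, w) ∈ rateRegion A B P → w ≤ v) :
    (s₁, s₂) ∈ rateRegion A₀ B₀ P := by
  obtain ⟨hs₁, hs₂, hc⟩ := hs
  refine ⟨hs₁, hs₂, ?_⟩
  by_contra! hcon
  have key := bilinear_neg_of_le (m := min A B - min A₀ B₀) (sub_nonneg.2 hAA)
    (sub_nonpos.2 hBB) (two_rpow_sub_one_pos hu) (two_rpow_sub_one_le hus)
    (two_rpow_sub_one_nonneg hs₂) (two_rpow_sub_one_le hsv)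
    (by dsimp only [powerCost] at hc hcon ⊢; linarith)
  have hcost : powerCost A B (2 ^ u - 1) (2 ^ v - 1) < P := by
    have := hmem.2.2
    dsimp only [powerCost] at this ⊢
    linarith
  obtain ⟨w, hvw, hw⟩ := exists_lt_mem_rateRegion hA hB hu.le hmem.2.1 hcost
  exact absurd (hmax w hw) (not_le.2 hvw)

theorem h1_pos {D H β0 : ℝ} (hH : 0 < H) (hβ : 0 < β0) (x : ℝ) : 0 < h1 D H β0 x := by
  unfold h1
  positivity

theorem h2_pos {D H β0 : ℝ} (hH : 0 < H) (hβ : 0 < β0) (x : ℝ) : 0 < h2 D H β0 x := by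
  unfold h2
  positivity

theorem h1_le_h1 {D H β0 x y : ℝ} (hH : 0 < H) (hβ : 0 < β0) (hx : -(D / 2) ≤ x)
    (hxy : x ≤ y) : h1 D H β0 y ≤ h1 D H β0 x := by
  unfold h1
  have : (x + D / 2) ^ 2 ≤ (y + D / 2) ^ 2 := pow_le_pow_left₀ (by linarith) (by linarith) 2
  gcongr

theorem h2_le_h2 {D H β0 x y : ℝ} (hH : 0 < H) (hβ : 0 < β0) (hy : y ≤ D / 2)
    (hxy : x ≤ y) : h2 D H β0 x ≤ h2 D H β0 y := by
  unfold h2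
  have : (y - D / 2) ^ 2 ≤ (x - D / 2) ^ 2 := by nlinarith
  gcongr

/-- Some power split serves the pair `(X, Y)` if and only if the power cost of the pair is within
the budget. -/
theorem exists_power_split_iff {a b P X Y : ℝ} (ha : 0 < a) (hb : 0 < b) (hX : 0 ≤ X)
    (hY : 0 ≤ Y) :
    (∃ p q : ℝ, 0 ≤ p ∧ 0 ≤ q ∧ p + q ≤ P ∧ X ≤ p * a ∧ Y ≤ q * b ∧
      X + Y + X * Y ≤ p * a + q * b) ↔ powerCost a⁻¹ b⁻¹ X Y ≤ P := by
  have ha' : 0 < a⁻¹ := inv_pos.2 ha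
  have hb' : 0 < b⁻¹ := inv_pos.2 hb
  have hXY : 0 ≤ X * Y := mul_nonneg hX hY
  unfold powerCost
  constructor
  · rintro ⟨p, q, hp, hq, hpq, h1, h2, h3⟩
    have ep : a⁻¹ * (p * a) = p := by field_simp
    have eq : b⁻¹ * (q * b) = q := by field_simp
    rcases le_total a⁻¹ b⁻¹ with h | h
    · rw [min_eq_left h]
      have t1 := mul_le_mul_of_nonneg_left h3 ha'.le
      have t2 := mul_le_mul_of_nonneg_left h2 (sub_nonneg.2 h)
      linarith
    · rw [min_eq_right h]
      have t1 := mul_le_mul_of_nonneg_left h3 hb'.le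
      have t2 := mul_le_mul_of_nonneg_left h1 (sub_nonneg.2 h)
      linarith
  · intro h
    rcases le_total a⁻¹ b⁻¹ with hab | hab
    · rw [min_eq_left hab] at h
      have e1 : a⁻¹ * (X + X * Y) * a = X + X * Y := by field_simp
      have e2 : b⁻¹ * Y * b = Y := by field_simp
      refine ⟨a⁻¹ * (X + X * Y), b⁻¹ * Y, by positivity, by positivity, ?_, ?_, ?_, ?_⟩ <;>
        linarith
    · rw [min_eq_right hab] at h
      have e1 : a⁻¹ * X * a = X := by field_simp
      have e2 : b⁻¹ * (Y + X * Y) * b = Y + X * Y := by field_simp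
      refine ⟨a⁻¹ * X, b⁻¹ * (Y + X * Y), by positivity, by positivity, ?_, ?_, ?_, ?_⟩ <;>
        linarith

theorem Cf_eq_rateRegion {D H β0 : ℝ} (P : ℝ) (hH : 0 < H) (hβ : 0 < β0) (x : ℝ) :
    Cf D H β0 P x = rateRegion (h1 D H β0 x)⁻¹ (h2 D H β0 x)⁻¹ P := by
  ext ⟨r₁, r₂⟩
  have ha := h1_pos (D := D) hH hβ x
  have hb := h2_pos (D := D) hH hβ x
  simp only [Cf, CMAC, rateRegion, Set.mem_ofPred_eq]
  have hcoord : ∀ p q : ℝ, 0 ≤ p → 0 ≤ q →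
      ((r₁ ≤ Real.logb 2 (1 + p * h1 D H β0 x) ∧ r₂ ≤ Real.logb 2 (1 + q * h2 D H β0 x) ∧
        r₁ + r₂ ≤ Real.logb 2 (1 + p * h1 D H β0 x + q * h2 D H β0 x)) ↔
      ((2 : ℝ) ^ r₁ - 1 ≤ p * h1 D H β0 x ∧ (2 : ℝ) ^ r₂ - 1 ≤ q * h2 D H β0 x ∧
        ((2 : ℝ) ^ r₁ - 1) + (2 ^ r₂ - 1) + (2 ^ r₁ - 1) * (2 ^ r₂ - 1) ≤
          p * h1 D H β0 x + q * h2 D H β0 x)) := by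
    intro p q hp hq
    rw [Real.le_logb_iff_rpow_le (by norm_num) (by positivity),
      Real.le_logb_iff_rpow_le (by norm_num) (by positivity),
      Real.le_logb_iff_rpow_le (by norm_num) (by positivity), Real.rpow_add (by norm_num)]
    refine and_congr ?_ (and_congr ?_ ?_) <;> constructor <;> intro h <;> linarith
  constructor
  · rintro ⟨p, q, hp, hq, hpq, hr₁, hr₂, h⟩
    exact ⟨hr₁, hr₂, (exists_power_split_iff ha hb (two_rpow_sub_one_nonneg hr₁)
      (two_rpow_sub_one_nonneg hr₂)).1 ⟨p, q, hp, hq, hpq, (hcoord p q hp hq).1 h⟩⟩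
  · rintro ⟨hr₁, hr₂, h⟩
    obtain ⟨p, q, hp, hq, hpq, h⟩ := (exists_power_split_iff ha hb
      (two_rpow_sub_one_nonneg hr₁) (two_rpow_sub_one_nonneg hr₂)).2 h
    exact ⟨p, q, hp, hq, hpq, hr₁, hr₂, (hcoord p q hp hq).2 h⟩

theorem convex_triangle (k c d : ℝ) :
    Convex ℝ {s : ℝ × ℝ | 0 ≤ s.1 ∧ 0 ≤ s.2 ∧ s.2 ≤ k * (s.1 - c) + d} := by
  rintro ⟨x₁, x₂⟩ ⟨hx₁, hx₂, hx⟩ ⟨y₁, y₂⟩ ⟨hy₁, hy₂, hy⟩ a b ha hb hab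
  simp only [Set.mem_ofPred_eq, Prod.fst_add, Prod.snd_add, Prod.smul_fst, Prod.smul_snd,
    smul_eq_mul] at *
  refine ⟨by positivity, by positivity, ?_⟩
  obtain rfl : b = 1 - a := by linarith
  linarith [mul_le_mul_of_nonneg_left hx ha, mul_le_mul_of_nonneg_left hy hb]

/-- A point under a chord between two rate regions lies in their convex hull. -/
theorem mem_convexHull_of_le_chord {A B A' B' P u v u' v' t s₁ s₂ : ℝ} (hA : 0 < A) (hB : 0 < B)
    (hA' : 0 < A') (hB' : 0 < B') (h : (u, v) ∈ rateRegion A B P)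
    (h' : (u', v') ∈ rateRegion A' B' P) (ht₀ : 0 ≤ t) (ht₁ : t ≤ 1)
    (hs₁ : s₁ = t * u + (1 - t) * u') (hs₀ : 0 ≤ s₂) (hs₂ : s₂ ≤ t * v + (1 - t) * v') :
    (s₁, s₂) ∈ convexHull ℝ (rateRegion A B P ∪ rateRegion A' B' P) := by
  have hline : 0 ≤ t * v + (1 - t) * v' := hs₀.trans hs₂
  obtain ⟨c, hc₀, hc₁, hcs⟩ : ∃ c, 0 ≤ c ∧ c ≤ 1 ∧ s₂ = c * (t * v + (1 - t) * v') := by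
    rcases hline.lt_or_eq with hl | hl
    · exact ⟨_, div_nonneg hs₀ hline, div_le_one_of_le₀ hs₂ hline,
        (div_mul_cancel₀ _ hl.ne').symm⟩
    · exact ⟨0, le_rfl, zero_le_one, by linarith⟩
  have m : (u, c * v) ∈ rateRegion A B P :=
    mem_rateRegion_of_le hA hB h (mul_nonneg hc₀ h.2.1) (mul_le_of_le_one_left h.2.1 hc₁)
  have m' : (u', c * v') ∈ rateRegion A' B' P :=
    mem_rateRegion_of_le hA' hB' h' (mul_nonneg hc₀ h'.2.1) (mul_le_of_le_one_left h'.2.1 hc₁)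
  have := convex_convexHull ℝ (rateRegion A B P ∪ rateRegion A' B' P)
    (subset_convexHull ℝ _ (Or.inl m)) (subset_convexHull ℝ _ (Or.inr m')) ht₀
    (sub_nonneg.2 ht₁) (by ring)
  convert this using 1
  ext
  · simpa using hs₁
  · simp only [Prod.snd_add, Prod.smul_snd, smul_eq_mul]
    rw [hcs]
    ring

/-- A line through a point of positive first rate in a rate region, supporting from above a rate
region with at least the same second gain, has negative slope. -/
theorem slope_neg_of_supports {A B A' B' P k u v : ℝ} (hA : 0 < A) (hA' : 0 < A')
    (hB' : 0 < B') (hBB : B' ≤ B) (hmem : (u, v) ∈ rateRegion A B P) (hu : 0 < u)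
    (hsupp : ∀ s ∈ rateRegion A' B' P, s.2 ≤ k * (s.1 - u) + v) : k < 0 := by
  have hX := two_rpow_sub_one_pos hu
  obtain ⟨-, hv, hc⟩ := hmem
  have hY := two_rpow_sub_one_nonneg hv
  have hm : 0 < min A B := lt_min hA (hB'.trans_le hBB)
  have hcost : powerCost A' B' (2 ^ (0 : ℝ) - 1) (2 ^ v - 1) < P := by
    refine lt_of_lt_of_le ?_ hc
    simp only [powerCost, Real.rpow_zero, sub_self, mul_zero, zero_mul, add_zero, zero_add]
    have h1 := mul_le_mul_of_nonneg_right hBB hY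
    have h2 : 0 < A * (2 ^ u - 1) := mul_pos hA hX
    have h3 : 0 ≤ min A B * ((2 ^ u - 1) * (2 ^ v - 1)) :=
      mul_nonneg hm.le (mul_nonneg hX.le hY)
    dsimp only at h1 h3
    linarith
  obtain ⟨w, hvw, hw⟩ := exists_lt_mem_rateRegion hA' hB' le_rfl hv hcost
  have := hsupp _ hw
  dsimp only at this
  by_contra! hk
  nlinarith

/-- (Lemma 5.) Let `-D/2 ≤ x_I < x_F ≤ D/2`, and let
`(r1I, r2I) ∈ C_f(x_I)` and `(r1F, r2F) ∈ C_f(x_F)` with `r1F < r1I` be the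
tangency points of the common upper tangent of slope
`k = (r2I - r2F)/(r1I - r1F)` of `Conv(C_f(x_I) ∪ C_f(x_F))`. Then for every
`x ∈ [x_I, x_F]`: `C_f(x) ⊆ Conv(C_f(x_I) ∪ C_f(x_F))` if and only if
`C_f(x) ⊆ C_IF`, where `C_IF` is the triangle bounded by the tangent line and
the axes. -/
theorem convex_hull_iff_triangle (D H β0 P xI xF r1I r2I r1F r2F : ℝ)
    (hD : 0 < D) (hH : 0 < H) (hβ : 0 < β0) (hP : 0 < P)
    (hI : -(D / 2) ≤ xI) (hIF : xI < xF) (hF : xF ≤ D / 2)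
    (hmemI : (r1I, r2I) ∈ Cf D H β0 P xI)
    (hmemF : (r1F, r2F) ∈ Cf D H β0 P xF)
    (hlt : r1F < r1I)
    (hsupp : ∀ s ∈ Cf D H β0 P xI ∪ Cf D H β0 P xF,
      s.2 ≤ (r2I - r2F) / (r1I - r1F) * (s.1 - r1I) + r2I) :
    ∀ x : ℝ, xI ≤ x → x ≤ xF →
      (Cf D H β0 P x ⊆ convexHull ℝ (Cf D H β0 P xI ∪ Cf D H β0 P xF) ↔
        Cf D H β0 P x ⊆
          {s : ℝ × ℝ | 0 ≤ s.1 ∧ 0 ≤ s.2 ∧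
            s.2 ≤ (r2I - r2F) / (r1I - r1F) * (s.1 - r1I) + r2I}) := by
  intro x hxI hxF
  have pI₁ := inv_pos.2 (h1_pos (D := D) hH hβ xI)
  have pI₂ := inv_pos.2 (h2_pos (D := D) hH hβ xI)
  have pF₁ := inv_pos.2 (h1_pos (D := D) hH hβ xF)
  have pF₂ := inv_pos.2 (h2_pos (D := D) hH hβ xF)
  have px₁ := inv_pos.2 (h1_pos (D := D) hH hβ x)
  have px₂ := inv_pos.2 (h2_pos (D := D) hH hβ x)
  have hI₁ := inv_anti₀ (h1_pos (D := D) hH hβ x) (h1_le_h1 hH hβ hI hxI)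
  have hI₂ := inv_anti₀ (h2_pos (D := D) hH hβ xI) (h2_le_h2 hH hβ (hxF.trans hF) hxI)
  have hF₁ := inv_anti₀ (h1_pos (D := D) hH hβ xF) (h1_le_h1 hH hβ (hI.trans hxI) hxF)
  have hF₂ := inv_anti₀ (h2_pos (D := D) hH hβ x) (h2_le_h2 hH hβ hF hxF)
  rw [Cf_eq_rateRegion P hH hβ] at hmemI hmemF
  simp only [Cf_eq_rateRegion P hH hβ] at hsupp ⊢
  have hk0 : (r2I - r2F) / (r1I - r1F) * (r1I - r1F) = r2I - r2F :=
    div_mul_cancel₀ _ (sub_pos.2 hlt).ne'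
  set k := (r2I - r2F) / (r1I - r1F)
  have hr1I : 0 < r1I := hmemF.1.trans_lt hlt
  have hk : k < 0 := slope_neg_of_supports pI₁ pF₁ pF₂ (hF₂.trans hI₂) hmemI hr1I
    fun s hs => hsupp s (Or.inr hs)
  have hr2F : 0 < r2F := by
    have := hmemI.2.1
    dsimp only at this
    nlinarith
  constructor
  · intro h
    refine h.trans (convexHull_min ?_ (convex_triangle k r1I r2I))
    intro s hs
    have hline := hsupp s hs
    rcases hs with hs | hs <;> exact ⟨hs.1, hs.2.1, hline⟩
  · rintro h ⟨s₁, s₂⟩ hs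
    obtain ⟨hs₁, hs₂, hline⟩ := h hs
    dsimp only at hs₁ hs₂ hline
    rcases le_total r1I s₁ with hright | hright
    · refine subset_convexHull ℝ _ (Or.inl ?_)
      refine mem_rateRegion_of_dominated px₁ px₂ hI₁ hI₂ hmemI hr1I hright ?_ hs ?_
      · nlinarith
      · intro w hw
        have := (h hw).2.2
        dsimp only at this
        linarith
    rcases le_total s₁ r1F with hleft | hleft
    · refine subset_convexHull ℝ _ (Or.inr (mem_rateRegion_swap ?_))
      by_cases hs₂F : r2F ≤ s₂
      · refine mem_rateRegion_of_dominated px₂ px₁ hF₂ hF₁ (mem_rateRegion_swap hmemF) hr2F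
          hs₂F hleft (mem_rateRegion_swap hs) ?_
        intro w hw
        have := (h (mem_rateRegion_swap hw)).2.2
        dsimp only at this
        nlinarith
      · have hmem := mem_rateRegion_of_le pF₁ pF₂ hmemF hs₂ (not_le.1 hs₂F).le
        exact mem_rateRegion_of_le pF₂ pF₁ (mem_rateRegion_swap hmem) hs₁ hleft
    · have hd : 0 < r1I - r1F := sub_pos.2 hlt
      have ht : (s₁ - r1F) / (r1I - r1F) * (r1I - r1F) = s₁ - r1F := div_mul_cancel₀ _ hd.ne'
      refine mem_convexHull_of_le_chord (t := (s₁ - r1F) / (r1I - r1F)) pI₁ pI₂ pF₁ pF₂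
        hmemI hmemF (div_nonneg (by linarith) hd.le) (div_le_one_of_le₀ (by linarith) hd.le)
        (by linarith) hs₂ (hline.trans_eq ?_)
      set t := (s₁ - r1F) / (r1I - r1F)
      linear_combination (t - 1) * hk0 - k * ht
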